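/- arXiv:1809.01016 — 4 statements merged into one kernel-verified Lean document; each statement's English description precedes it below -/
import Mathlib

section
/- Let I be a real 3×3 matrix indexed by (x, y) ∈ {−1, 0, 1}². If for every choice of parameters θ, ψ ∈ ℝ, σ ≠ 0, γ ∈ ℝ, λ ≠ 0, the sum Σ_{x ∈ {−1,0,1}} Σ_{y ∈ {−1,0,1}} I_{x,y} · g_{θ,σ,γ,λ,ψ}(x, y) = 0, then I = 0. (Core claim in the proof of Proposition 2: no nonzero 3×3 matrix is orthogonal to every 3×3 Gabor kernel.) -/
/-- The Gabor filter function `g_{θ,σ,γ,λ,ψ}(x, y)`. -/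
noncomputable def gabor (θ σ γ lam ψ : ℝ) (x y : ℝ) : ℝ :=
  let x' : ℝ := x * Real.cos θ + y * Real.sin θ
  let y' : ℝ := -x * Real.sin θ + y * Real.cos θ
  Real.exp (-(x' ^ 2 + γ ^ 2 * y' ^ 2) / (2 * σ ^ 2)) *
    Real.cos (2 * Real.pi * x' / lam + ψ)

/-- Coordinate of a `Fin 3` index in `{-1, 0, 1}`. -/
def coord (i : Fin 3) : ℝ := (i : ℝ) - 1

lemma gabor_key (I : Matrix (Fin 3) (Fin 3) ℝ)
    (h : ∀ (θ σ γ lam ψ : ℝ), σ ≠ 0 → lam ≠ 0 →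
      ∑ x : Fin 3, ∑ y : Fin 3, I x y * gabor θ σ γ lam ψ (coord x) (coord y) = 0)
    (u v ψ : ℝ) (huv : u ≠ 0 ∨ v ≠ 0) :
    ∑ x : Fin 3, ∑ y : Fin 3, (I x y * Real.exp (-(coord x ^ 2 + coord y ^ 2) / 2)) *
      Real.cos (u * coord x + v * coord y + ψ) = 0 := by
  have hz : (⟨u, v⟩ : ℂ) ≠ 0 := by
    intro h0
    have h1 := congrArg Complex.re h0
    have h2 := congrArg Complex.im h0
    simp at h1 h2
    tauto
  have hr : ‖(⟨u, v⟩ : ℂ)‖ ≠ 0 := norm_ne_zero_iff.mpr hz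
  have hc := Complex.norm_mul_cos_arg (⟨u, v⟩ : ℂ)
  have hs := Complex.norm_mul_sin_arg (⟨u, v⟩ : ℂ)
  have hpi := Real.pi_ne_zero
  generalize ‖(⟨u, v⟩ : ℂ)‖ = r at *
  generalize Complex.arg (⟨u, v⟩ : ℂ) = t at *
  simp only at hc hs
  rw [← h t 1 1 (2 * Real.pi / r) ψ one_ne_zero (by positivity)]
  refine Finset.sum_congr rfl fun x _ => Finset.sum_congr rfl fun y _ => ?_
  rw [mul_assoc]
  congr 1
  simp only [gabor]
  congr 2
  · have := Real.sin_sq_add_cos_sq t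
    linear_combination ((coord x ^ 2 + coord y ^ 2) / 2) * this
  · rw [← hc, ← hs]
    field_simp

theorem matrix_eq_zero_of_orth_all_gabor (I : Matrix (Fin 3) (Fin 3) ℝ)
    (h : ∀ (θ σ γ lam ψ : ℝ), σ ≠ 0 → lam ≠ 0 →
      ∑ x : Fin 3, ∑ y : Fin 3, I x y * gabor θ σ γ lam ψ (coord x) (coord y) = 0) :
    I = 0 := by
  have key := gabor_key I h
  have hpi := Real.pi_ne_zero
  obtain ⟨J, hJ⟩ : ∃ J : Fin 3 → Fin 3 → ℝ, ∀ x y, J x y =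
    I x y * Real.exp (-(coord x ^ 2 + coord y ^ 2) / 2) := ⟨_, fun _ _ => rfl⟩
  simp only [← hJ] at key
  have c0 : coord 0 = -1 := by simp [coord]
  have c1 : coord 1 = 0 := by simp [coord]
  have c2 : coord 2 = 1 := by simp [coord]; norm_num
  simp only [Fin.sum_univ_three, c0, c1, c2, mul_neg, mul_one, mul_zero, Real.cos_add,
    Real.sin_add, Real.cos_neg, Real.sin_neg, Real.cos_zero, Real.sin_zero] at key
  have e1 := key (2 * Real.pi) 0 0 (by simp)
  have e2 := key (Real.pi / 2) 0 0 (by simp)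
  have e3 := key (Real.pi) 0 0 (by simp)
  have e4 := key 0 (Real.pi / 2) 0 (by simp)
  have e5 := key (Real.pi / 2) (Real.pi / 2) 0 (by simp)
  have e6 := key (Real.pi) (Real.pi / 2) 0 (by simp)
  have e7 := key 0 (Real.pi) 0 (by simp)
  have e8 := key (Real.pi / 2) (Real.pi) 0 (by simp)
  have e9 := key (Real.pi) (Real.pi) 0 (by simp)
  have f2 := key (Real.pi / 2) 0 (Real.pi / 2) (by simp)
  have f4 := key 0 (Real.pi / 2) (Real.pi / 2) (by simp)
  have f5 := key (Real.pi / 2) (Real.pi / 2) (Real.pi / 2) (by simp)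
  have f6 := key (Real.pi) (Real.pi / 2) (Real.pi / 2) (by simp)
  have f8 := key (Real.pi / 2) (Real.pi) (Real.pi / 2) (by simp)
  clear key
  simp only [Real.cos_two_pi, Real.sin_two_pi, Real.cos_pi_div_two, Real.sin_pi_div_two,
    Real.cos_pi, Real.sin_pi, Real.cos_zero, Real.sin_zero] at *
  have hz : ∀ x y, J x y = 0 := by
    intro x y
    fin_cases x <;> fin_cases y <;> simp only [Fin.zero_eta, Fin.mk_one, Fin.reduceFinMk] <;>
      linarith
  ext x y
  have := hz x y
  rw [hJ] at this
  simpa [Real.exp_ne_zero] using this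
end

section
/- There exist a positive integer od and parameter tuples p¹, …, p^{od}, each of the form pᵗ = (θᵗ, σᵗ, γᵗ, λᵗ, ψᵗ) with σᵗ ≠ 0 and λᵗ ≠ 0, such that for every real 3×3 matrix I indexed by (x, y) ∈ {−1, 0, 1}²: if Σ_{x ∈ {−1,0,1}} Σ_{y ∈ {−1,0,1}} I_{x,y} · g_{pᵗ}(x, y) = 0 for every t = 1, …, od, then I = 0. (Proposition 2: there exists a kernel in the Gabor parametric convolutional kernel space satisfying the injectivity condition.) -/
lemma gab_aux (θ lam ψ m n : ℝ) (hm : Real.cos θ / lam = m / 3) (hn : Real.sin θ / lam = n / 3)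
    (x y : ℝ) : gabor θ 1 1 lam ψ x y =
      Real.exp (-(x ^ 2 + y ^ 2) / 2) * Real.cos ((m * x + n * y) * (2 * Real.pi / 3) + ψ) := by
  unfold gabor
  have h1 : (x * Real.cos θ + y * Real.sin θ) ^ 2 +
      1 ^ 2 * (-x * Real.sin θ + y * Real.cos θ) ^ 2 = x ^ 2 + y ^ 2 := by
    linear_combination (x ^ 2 + y ^ 2) * Real.sin_sq_add_cos_sq θ
  have h2 : 2 * Real.pi * (x * Real.cos θ + y * Real.sin θ) / lam =
      (m * x + n * y) * (2 * Real.pi / 3) := by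
    have : 2 * Real.pi * (x * Real.cos θ + y * Real.sin θ) / lam =
      2 * Real.pi * (x * (Real.cos θ / lam) + y * (Real.sin θ / lam)) := by ring
    rw [this, hm, hn]; ring
  simp only [h1, h2]
  norm_num

lemma c1 : Real.cos (2 * Real.pi / 3) = -1 / 2 := by
  rw [show 2 * Real.pi / 3 = Real.pi - Real.pi / 3 by ring, Real.cos_pi_sub, Real.cos_pi_div_three]
  norm_num
lemma s1 : Real.sin (2 * Real.pi / 3) = √3 / 2 := by
  rw [show 2 * Real.pi / 3 = Real.pi - Real.pi / 3 by ring, Real.sin_pi_sub, Real.sin_pi_div_three]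
lemma c2 : Real.cos (2 * (2 * Real.pi / 3)) = -1 / 2 := by
  rw [Real.cos_two_mul, c1]; norm_num
lemma s2 : Real.sin (2 * (2 * Real.pi / 3)) = -(√3 / 2) := by
  rw [Real.sin_two_mul, c1, s1]; ring

/-- **Proposition 2.** There exist a positive number `od` of Gabor parameter tuples
`pᵗ = (θᵗ, σᵗ, γᵗ, λᵗ, ψᵗ)` (with `σᵗ ≠ 0`, `λᵗ ≠ 0`) such that the only real 3×3
matrix orthogonal to all of the generated 3×3 Gabor kernels is the zero matrix. -/
theorem exists_gabor_kernels_injectivity_condition :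
    ∃ (od : ℕ), 0 < od ∧ ∃ θ σ γ lam ψ : Fin od → ℝ,
      (∀ t, σ t ≠ 0) ∧ (∀ t, lam t ≠ 0) ∧
      ∀ I : Matrix (Fin 3) (Fin 3) ℝ,
        (∀ t : Fin od,
          ∑ x : Fin 3, ∑ y : Fin 3,
            I x y * gabor (θ t) (σ t) (γ t) (lam t) (ψ t) (coord x) (coord y) = 0) →
        I = 0 := by
  have q : √2 ≠ 0 := by positivity
  have q2 : √2 * √2 = 2 := Real.mul_self_sqrt (by norm_num)
  refine ⟨9, by norm_num,
    ![0, 0, 0, Real.pi / 2, Real.pi / 2, Real.pi / 4, Real.pi / 4, -(Real.pi / 4), -(Real.pi / 4)],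
    fun _ => 1, fun _ => 1,
    ![1, 3, 3, 3, 3, 3 * √2 / 2, 3 * √2 / 2, 3 * √2 / 2, 3 * √2 / 2],
    ![0, 0, -(Real.pi / 2), 0, -(Real.pi / 2), 0, -(Real.pi / 2), 0, -(Real.pi / 2)],
    by simp, by intro t; fin_cases t <;> simp, ?_⟩
  intro I h
  have e0 : ∑ x : Fin 3, ∑ y : Fin 3, I x y * gabor 0 1 1 1 0 (coord x) (coord y) = 0 := h 0
  have e1 : ∑ x : Fin 3, ∑ y : Fin 3, I x y * gabor 0 1 1 3 0 (coord x) (coord y) = 0 := h 1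
  have e2 : ∑ x : Fin 3, ∑ y : Fin 3, I x y * gabor 0 1 1 3 (-(Real.pi / 2)) (coord x) (coord y) = 0 := h 2
  have e3 : ∑ x : Fin 3, ∑ y : Fin 3, I x y * gabor (Real.pi / 2) 1 1 3 0 (coord x) (coord y) = 0 := h 3
  have e4 : ∑ x : Fin 3, ∑ y : Fin 3, I x y * gabor (Real.pi / 2) 1 1 3 (-(Real.pi / 2)) (coord x) (coord y) = 0 := h 4
  have e5 : ∑ x : Fin 3, ∑ y : Fin 3, I x y * gabor (Real.pi / 4) 1 1 (3 * √2 / 2) 0 (coord x) (coord y) = 0 := h 5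
  have e6 : ∑ x : Fin 3, ∑ y : Fin 3, I x y * gabor (Real.pi / 4) 1 1 (3 * √2 / 2) (-(Real.pi / 2)) (coord x) (coord y) = 0 := h 6
  have e7 : ∑ x : Fin 3, ∑ y : Fin 3, I x y * gabor (-(Real.pi / 4)) 1 1 (3 * √2 / 2) 0 (coord x) (coord y) = 0 := h 7
  have e8 : ∑ x : Fin 3, ∑ y : Fin 3, I x y * gabor (-(Real.pi / 4)) 1 1 (3 * √2 / 2) (-(Real.pi / 2)) (coord x) (coord y) = 0 := h 8
  clear h
  have z : √2 / 2 / (3 * √2 / 2) = 1 / 3 := by field_simp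
  have z' : -(√2 / 2) / (3 * √2 / 2) = (-1) / 3 := by field_simp
  have k0 := fun ψ => gab_aux 0 1 ψ 3 0 (by simp) (by simp)
  have k1 := fun ψ => gab_aux 0 3 ψ 1 0 (by simp) (by simp)
  have k2 := fun ψ => gab_aux (Real.pi / 2) 3 ψ 0 1 (by simp) (by simp)
  have k3 := fun ψ => gab_aux (Real.pi / 4) (3 * √2 / 2) ψ 1 1 (by simpa using z) (by simpa using z)
  have k4 := fun ψ => gab_aux (-(Real.pi / 4)) (3 * √2 / 2) ψ 1 (-1)
    (by rw [Real.cos_neg, Real.cos_pi_div_four]; exact z)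
    (by rw [Real.sin_neg, Real.sin_pi_div_four]; exact z')
  have sh : ∀ a : ℝ, Real.cos (a + -(Real.pi / 2)) = Real.sin a := fun a => by
    rw [← sub_eq_add_neg, Real.cos_sub_pi_div_two]
  have f3 : Real.cos (3 * (2 * Real.pi / 3)) = 1 := by
    rw [show 3 * (2 * Real.pi / 3) = 2 * Real.pi by ring, Real.cos_two_pi]
  have g0 : coord 0 = -1 := by norm_num [coord]
  have g1 : coord 1 = 0 := by norm_num [coord]
  have g2 : coord 2 = 1 := by norm_num [coord]
  have r : √3 ≠ 0 := by positivity
  have hp : (1:ℝ) + 1 = 2 := by norm_num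
  have hq : (-1:ℝ) + -1 = -2 := by norm_num
  obtain ⟨w, hw, hw0⟩ : ∃ w : ℝ → ℝ → ℝ, (∀ x y, Real.exp (-(x ^ 2 + y ^ 2) / 2) = w x y) ∧
      ∀ x y, w x y ≠ 0 := ⟨fun x y => Real.exp (-(x ^ 2 + y ^ 2) / 2), fun _ _ => rfl,
        fun _ _ => Real.exp_ne_zero _⟩
  simp only [Fin.sum_univ_three, g0, g1, g2, hw, neg_zero, k0, k1, k2, k3, k4, sh, add_zero, zero_add, mul_zero,
    zero_mul, mul_one, one_mul, mul_neg, neg_mul, neg_neg, hp, hq, Real.cos_neg, Real.sin_neg,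
    Real.cos_zero, Real.sin_zero, c1, s1, c2, s2, f3, neg_add_cancel, add_neg_cancel] at e0 e1 e2 e3 e4 e5 e6 e7 e8
  have d2 : I 2 0 * w 1 (-1) + I 2 1 * w 1 0 + I 2 2 * w 1 1 - (I 0 0 * w (-1) (-1) + I 0 1 * w (-1) 0 + I 0 2 * w (-1) 1) = 0 := by
    apply mul_left_cancel₀ r; linear_combination 2 * e2
  have d4 : I 0 2 * w (-1) 1 + I 1 2 * w 0 1 + I 2 2 * w 1 1 - (I 0 0 * w (-1) (-1) + I 1 0 * w 0 (-1) + I 2 0 * w 1 (-1)) = 0 := by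
    apply mul_left_cancel₀ r; linear_combination 2 * e4
  have d6 : I 0 0 * w (-1) (-1) + I 1 2 * w 0 1 + I 2 1 * w 1 0 - (I 0 1 * w (-1) 0 + I 1 0 * w 0 (-1) + I 2 2 * w 1 1) = 0 := by
    apply mul_left_cancel₀ r; linear_combination 2 * e6
  have d8 : I 0 2 * w (-1) 1 + I 1 0 * w 0 (-1) + I 2 1 * w 1 0 - (I 0 1 * w (-1) 0 + I 1 2 * w 0 1 + I 2 0 * w 1 (-1)) = 0 := by
    apply mul_left_cancel₀ r; linear_combination 2 * e8
  have j00 : I 0 0 * w (-1) (-1) = 0 := by linarith only [e0, e1, d2, e3, d4, e5, d6, e7, d8]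
  have j01 : I 0 1 * w (-1) 0 = 0 := by linarith only [e0, e1, d2, e3, d4, e5, d6, e7, d8]
  have j02 : I 0 2 * w (-1) 1 = 0 := by linarith only [e0, e1, d2, e3, d4, e5, d6, e7, d8]
  have j10 : I 1 0 * w 0 (-1) = 0 := by linarith only [e0, e1, d2, e3, d4, e5, d6, e7, d8]
  have j11 : I 1 1 * w 0 0 = 0 := by linarith only [e0, e1, d2, e3, d4, e5, d6, e7, d8]
  have j12 : I 1 2 * w 0 1 = 0 := by linarith only [e0, e1, d2, e3, d4, e5, d6, e7, d8]
  have j20 : I 2 0 * w 1 (-1) = 0 := by linarith only [e0, e1, d2, e3, d4, e5, d6, e7, d8]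
  have j21 : I 2 1 * w 1 0 = 0 := by linarith only [e0, e1, d2, e3, d4, e5, d6, e7, d8]
  have j22 : I 2 2 * w 1 1 = 0 := by linarith only [e0, e1, d2, e3, d4, e5, d6, e7, d8]
  simp only [mul_eq_zero, hw0, or_false] at j00 j01 j02 j10 j11 j12 j20 j21 j22
  ext i j
  fin_cases i <;> fin_cases j <;> assumption
end

section
/- There exist a positive integer od and Gabor parameter tuples p¹, …, p^{od} (each pᵗ = (θᵗ, σᵗ, γᵗ, λᵗ, ψᵗ) with σᵗ ≠ 0, λᵗ ≠ 0) such that for all p, q ≥ 3, the linear map from ℝ^{p×q} to the od-tuple of feature maps, I ↦ (C_{k¹}(I), …, C_{k^{od}}(I)), where kᵗ is the 3×3 Gabor kernel with parameters pᵗ and C_{kᵗ} is valid 2D discrete convolution, is injective. (Corollary 1: a GO-CNN whose first-layer generator function is the Gabor filter function is well-defined.) -/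
/-- The 3×3 Gabor kernel with parameters `(θ, σ, γ, λ, ψ)`. -/
noncomputable def gaborKernel (θ σ γ lam ψ : ℝ) : Matrix (Fin 3) (Fin 3) ℝ :=
  fun x y => gabor θ σ γ lam ψ (coord x) (coord y)

/-- Valid 2D discrete convolution of an input `I : ℝ^{p×q}` with a kernel `k : ℝ^{m×m}`. -/
noncomputable def conv2d (p q m : ℕ) (hp : m ≤ p) (hq : m ≤ q)
    (k : Matrix (Fin m) (Fin m) ℝ) (I : Matrix (Fin p) (Fin q) ℝ) :
    Matrix (Fin (p - m + 1)) (Fin (q - m + 1)) ℝ :=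
  fun i j => ∑ s : Fin m, ∑ t : Fin m,
    I ⟨i.val + s.val, by have h1 := i.isLt; have h2 := s.isLt; omega⟩
      ⟨j.val + t.val, by have h1 := j.isLt; have h2 := t.isLt; omega⟩ * k s t

def gq (z : ℤ) : ℝ := if z % 4 = 0 then 1 else if z % 4 = 2 then -1 else 0

theorem cos_gq (z : ℤ) : Real.cos (Real.pi / 2 * z) = gq z := by
  have hz : z = z % 4 + 4 * (z / 4) := (Int.emod_add_mul_ediv z 4).symm
  have h1 : Real.cos (Real.pi / 2 * z) = Real.cos (Real.pi / 2 * ((z % 4 : ℤ) : ℝ)) := by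
    have : Real.pi / 2 * (z : ℝ)
        = Real.pi / 2 * ((z % 4 : ℤ) : ℝ) + ((z / 4 : ℤ) : ℝ) * (2 * Real.pi) := by
      conv_lhs => rw [hz]
      push_cast
      ring
    rw [this, Real.cos_add_int_mul_two_pi]
  rw [h1]
  have h2 : z % 4 = 0 ∨ z % 4 = 1 ∨ z % 4 = 2 ∨ z % 4 = 3 := by omega
  unfold gq
  rcases h2 with h | h | h | h <;> rw [h]
  · simp
  · simp
  · have : Real.pi / 2 * ((2 : ℤ) : ℝ) = Real.pi := by push_cast; ring
    rw [this]; simp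
  · have : Real.pi / 2 * ((3 : ℤ) : ℝ) = Real.pi / 2 + Real.pi := by push_cast; ring
    rw [this, Real.cos_add_pi]; simp

theorem exists_params (u v ψ : ℝ) (h : u ≠ 0 ∨ v ≠ 0) :
    ∃ θ lam : ℝ, lam ≠ 0 ∧ ∀ x y : ℝ, gabor θ 1 1 lam ψ x y
      = Real.exp (-(x ^ 2 + y ^ 2) / 2) * Real.cos (u * x + v * y + ψ) := by
  let z : ℂ := ⟨u, v⟩
  have hz : z ≠ 0 := by
    intro h0
    have h1 := congrArg Complex.re h0
    have h2 := congrArg Complex.im h0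
    simp [z] at h1 h2
    tauto
  have hn : ‖z‖ ≠ 0 := norm_ne_zero_iff.mpr hz
  have hu : ‖z‖ * Real.cos z.arg = u := Complex.norm_mul_cos_arg z
  have hv : ‖z‖ * Real.sin z.arg = v := Complex.norm_mul_sin_arg z
  refine ⟨z.arg, 2 * Real.pi / ‖z‖, by have := Real.pi_ne_zero; positivity, fun x y => ?_⟩
  unfold gabor
  simp only
  congr 1
  · congr 1
    have := Real.sin_sq_add_cos_sq z.arg
    linear_combination (-(x ^ 2 + y ^ 2) / 2) * this
  · congr 1
    have hp := Real.pi_ne_zero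
    rw [← hu, ← hv]
    field_simp
    try ring

def Mq : Fin 9 → ℤ := ![4, 2, 0, 2, 1, 1, 0, 2, 1]
def Nq : Fin 9 → ℤ := ![0, 0, 2, 2, 0, 2, 1, 1, 1]
def Kq : Fin 9 → ℤ := ![0, 0, 0, 0, 1, 1, 1, 1, 0]

theorem lin_zero (d : Fin 3 → Fin 3 → ℝ)
    (h : ∀ r : Fin 9, ∑ s : Fin 3, ∑ t : Fin 3,
      d s t * gq (Mq r * ((s.val : ℤ) - 1) + Nq r * ((t.val : ℤ) - 1) + Kq r) = 0) :
    ∀ s t, d s t = 0 := by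
  have h0 := h 0
  have h1 := h 1
  have h2 := h 2
  have h3 := h 3
  have h4 := h 4
  have h5 := h 5
  have h6 := h 6
  have h7 := h 7
  have h8 := h 8
  clear h
  simp [Fin.sum_univ_three, gq, Mq, Nq, Kq] at h0 h1 h2 h3 h4 h5 h6 h7 h8
  intro s t
  fin_cases s <;> fin_cases t <;> simp <;> linarith

/-- **Corollary 1.** There exist `od` Gabor parameter tuples (with `σᵗ ≠ 0`, `λᵗ ≠ 0`)
such that for all input sizes `p, q ≥ 3`, the map sending an input image to the tuple of
its valid convolutions with the corresponding 3×3 Gabor kernels is injective; that is,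
a GO-CNN whose first-layer generator is the Gabor filter function is well-defined. -/
theorem gabor_first_layer_injective :
    ∃ (od : ℕ), 0 < od ∧ ∃ θ σ γ lam ψ : Fin od → ℝ,
      (∀ t, σ t ≠ 0) ∧ (∀ t, lam t ≠ 0) ∧
      ∀ (p q : ℕ) (hp : 3 ≤ p) (hq : 3 ≤ q),
        Function.Injective (fun I : Matrix (Fin p) (Fin q) ℝ =>
          fun t : Fin od =>
            conv2d p q 3 hp hq (gaborKernel (θ t) (σ t) (γ t) (lam t) (ψ t)) I) := by
  have hne : ∀ r : Fin 9, Real.pi / 2 * (Mq r : ℝ) ≠ 0 ∨ Real.pi / 2 * (Nq r : ℝ) ≠ 0 := by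
    intro r
    have hp := Real.pi_ne_zero
    fin_cases r <;> simp [Mq, Nq, hp]
  choose θ lam hlam hg using fun r : Fin 9 =>
    exists_params (Real.pi / 2 * (Mq r : ℝ)) (Real.pi / 2 * (Nq r : ℝ))
      (Real.pi / 2 * (Kq r : ℝ)) (hne r)
  refine ⟨9, by norm_num, θ, fun _ => 1, fun _ => 1, lam,
    fun r => Real.pi / 2 * (Kq r : ℝ), fun _ => one_ne_zero, hlam, ?_⟩
  intro p q hp hq I J hIJ
  have key : ∀ (i : Fin (p - 3 + 1)) (j : Fin (q - 3 + 1)) (s t : Fin 3),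
      I ⟨i.val + s.val, by omega⟩ ⟨j.val + t.val, by omega⟩
        = J ⟨i.val + s.val, by omega⟩ ⟨j.val + t.val, by omega⟩ := by
    intro i j
    have hz := lin_zero (fun s t =>
      (I ⟨i.val + s.val, by omega⟩ ⟨j.val + t.val, by omega⟩
        - J ⟨i.val + s.val, by omega⟩ ⟨j.val + t.val, by omega⟩)
        * Real.exp (-(coord s ^ 2 + coord t ^ 2) / 2)) (by
      intro r
      have h := congrFun (congrFun (congrFun hIJ r) i) j
      simp only [conv2d, gaborKernel] at h
      rw [← sub_eq_zero, ← Finset.sum_sub_distrib] at h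
      rw [← h]
      refine Finset.sum_congr rfl fun s _ => ?_
      rw [← Finset.sum_sub_distrib]
      refine Finset.sum_congr rfl fun t _ => ?_
      rw [hg, ← cos_gq]
      have e : Real.pi / 2 * ((Mq r * ((s.val : ℤ) - 1) + Nq r * ((t.val : ℤ) - 1) + Kq r : ℤ) : ℝ)
          = Real.pi / 2 * (Mq r : ℝ) * coord s + Real.pi / 2 * (Nq r : ℝ) * coord t
            + Real.pi / 2 * (Kq r : ℝ) := by
        unfold coord
        push_cast
        ring
      rw [e]
      ring)
    intro s t
    have h := hz s t
    rcases mul_eq_zero.mp h with h | h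
    · exact sub_eq_zero.mp h
    · exact absurd h (Real.exp_pos _).ne'
  ext a b
  have h := key ⟨min a.val (p - 3), by omega⟩ ⟨min b.val (q - 3), by omega⟩
    ⟨a.val - min a.val (p - 3), by omega⟩ ⟨b.val - min b.val (q - 3), by omega⟩
  have ha : min a.val (p - 3) + (a.val - min a.val (p - 3)) = a.val := by omega
  have hb : min b.val (q - 3) + (b.val - min b.val (q - 3)) = b.val := by omega
  simpa only [ha, hb, Fin.eta] using h
end

section
/- Fix input size p ≥ 3 and a dataset S = {(I_i, y_i)}_{i=1}^N with I_i ∈ ℝ^{p×p} and y_i ∈ {0,1}. Let f : ℝⁿ → ℝ^{3×3} be a generator function such that some choice of od ∈ ℕ and parameters p¹, …, p^{od} makes the first-layer convolution map I ↦ (C_{f(p¹)}(I), …, C_{f(p^{od})}(I)) injective. Then for every common CNN F (one convolutional layer followed by two fully-connected layers with sigmoid activations) and every ε > 0, there exists d* ∈ ℕ such that for every first-fully-connected-layer width d₁ ≥ d*, there exists a well-defined GO-CNN G with generator f and first-fully-connected-layer width d₁ satisfying |Ê_S[G] − Ê_S[F]| ≤ ε. (Theorem 1) -/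
/-- The sigmoid activation `σ(t) = 1 / (1 + e^{-t})`. -/
noncomputable def sigmoid (t : ℝ) : ℝ := 1 / (1 + Real.exp (-t))

/-- Pre-activation output of a CNN with one convolutional layer (with `d₀` kernels of
size 3×3) followed by two fully-connected layers with sigmoid activations:
`F(x) = a₂ ⬝ σ(A₁ ⬝ σ(vec(C(x)) + b₀) + b₁) + b₂`. -/
noncomputable def cnnOut {p d₀ d₁ : ℕ} (hp : 3 ≤ p)
    (ker : Fin d₀ → Matrix (Fin 3) (Fin 3) ℝ)
    (b₀ : Fin d₀ × Fin (p - 3 + 1) × Fin (p - 3 + 1) → ℝ)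
    (A₁ : Matrix (Fin d₁) (Fin d₀ × Fin (p - 3 + 1) × Fin (p - 3 + 1)) ℝ)
    (b₁ : Fin d₁ → ℝ) (a₂ : Fin d₁ → ℝ) (b₂ : ℝ)
    (x : Matrix (Fin p) (Fin p) ℝ) : ℝ :=
  let feat : Fin d₀ × Fin (p - 3 + 1) × Fin (p - 3 + 1) → ℝ :=
    fun q => conv2d p p 3 hp hp (ker q.1) x q.2.1 q.2.2
  let h₀ : Fin d₀ × Fin (p - 3 + 1) × Fin (p - 3 + 1) → ℝ :=
    fun q => sigmoid (feat q + b₀ q)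
  let h₁ : Fin d₁ → ℝ := fun i => sigmoid (A₁.mulVec h₀ i + b₁ i)
  (∑ i : Fin d₁, a₂ i * h₁ i) + b₂

open Filter Topology in
theorem sigmoid_exp_tendsto (u : ℝ) :
    Tendsto (fun b : ℝ => Real.exp b * sigmoid (u + -b)) atTop (𝓝 (Real.exp u)) := by
  have h1 : (fun b : ℝ => Real.exp b * sigmoid (u + -b))
      = fun b : ℝ => 1 / (Real.exp (-b) + Real.exp (-u)) := by
    funext b
    unfold sigmoid
    have e1 : Real.exp (-(u + -b)) = Real.exp b * Real.exp (-u) := by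
      rw [← Real.exp_add]; congr 1; ring
    have e2 : Real.exp (-b) = 1 / Real.exp b := by rw [Real.exp_neg]; simp
    have := Real.exp_pos b
    have := Real.exp_pos (-u)
    rw [e1, e2]
    field_simp
  rw [h1]
  have h2 : Tendsto (fun b : ℝ => Real.exp (-b) + Real.exp (-u)) atTop
      (𝓝 (0 + Real.exp (-u))) :=
    Real.tendsto_exp_neg_atTop_nhds_zero.add tendsto_const_nhds
  have h3 := h2.inv₀ (by have := Real.exp_pos (-u); linarith)
  simpa [Real.exp_neg] using h3

theorem sigmoid_injective : Function.Injective sigmoid := by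
  intro a b h
  unfold sigmoid at h
  have ha := Real.exp_pos (-a)
  have hb := Real.exp_pos (-b)
  have h' : 1 + Real.exp (-a) = 1 + Real.exp (-b) := by
    simpa using h
  have := Real.exp_injective (add_left_cancel h')
  linarith

open Filter Topology in
theorem sigmoid_span_top {X Q : Type*} [Fintype X] [Fintype Q] (g : X → Q → ℝ)
    (hg : Function.Injective g) (c : X → ℝ) :
    c ∈ Submodule.span ℝ (Set.range fun (wb : (Q → ℝ) × ℝ) =>
      fun x => sigmoid ((∑ q, wb.1 q * g x q) + wb.2)) := by
  classical
  set W := Submodule.span ℝ (Set.range fun (wb : (Q → ℝ) × ℝ) =>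
      fun x => sigmoid ((∑ q, wb.1 q * g x q) + wb.2)) with hW
  have hcl : IsClosed (W : Set (X → ℝ)) := W.closed_of_finiteDimensional
  let E : Submonoid (X → ℝ) :=
    { carrier := Set.range fun (w : Q → ℝ) => fun x => Real.exp (∑ q, w q * g x q)
      one_mem' := ⟨0, by funext x; simp⟩
      mul_mem' := by
        rintro _ _ ⟨w, rfl⟩ ⟨w', rfl⟩
        refine ⟨w + w', ?_⟩
        funext x
        simp [add_mul, Finset.sum_add_distrib, Real.exp_add] }
  have hEW : (E : Set (X → ℝ)) ⊆ W := by
    rintro _ ⟨w, rfl⟩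
    have ht : Tendsto (fun b : ℝ => Real.exp b •
        fun x : X => sigmoid ((∑ q, w q * g x q) + -b)) atTop
        (𝓝 (fun x => Real.exp (∑ q, w q * g x q))) := by
      rw [tendsto_pi_nhds]
      intro x
      exact sigmoid_exp_tendsto _
    refine hcl.mem_of_tendsto ht (Eventually.of_forall fun b => ?_)
    exact W.smul_mem _ (Submodule.subset_span ⟨(w, -b), rfl⟩)
  have hAW : ∀ z ∈ Algebra.adjoin ℝ (E : Set (X → ℝ)), z ∈ W := by
    intro z hz
    have : z ∈ Subalgebra.toSubmodule (Algebra.adjoin ℝ (E : Set (X → ℝ))) := hz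
    rw [Algebra.adjoin_eq_span, Submonoid.closure_eq] at this
    exact (Submodule.span_le.2 hEW) this
  have hfac : ∀ x y : X, y ≠ x → ∃ z ∈ Algebra.adjoin ℝ (E : Set (X → ℝ)),
      z x = 1 ∧ z y = 0 := by
    intro x y hxy
    have : ∃ q, g y q ≠ g x q := by
      by_contra! h
      exact hxy (hg (funext h))
    obtain ⟨q, hq⟩ := this
    let e : X → ℝ := fun x => Real.exp (g x q)
    have he : e ∈ Algebra.adjoin ℝ (E : Set (X → ℝ)) :=
      Algebra.subset_adjoin ⟨Pi.single q 1, by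
        funext x; simp [e, Pi.single_apply]⟩
    have hne : e x - e y ≠ 0 := by
      intro h
      exact hq (Real.exp_injective (sub_eq_zero.1 h)).symm
    refine ⟨(e x - e y)⁻¹ • (e - algebraMap ℝ _ (e y)),
      Subalgebra.smul_mem _ (Subalgebra.sub_mem _ he (Subalgebra.algebraMap_mem _ _)) _, ?_, ?_⟩
    · simp [hne]
    · simp
  choose! z hz hz1 hz0 using hfac
  have hsing : ∀ x, (Pi.single x 1 : X → ℝ) ∈ W := by
    intro x
    have : (Pi.single x 1 : X → ℝ) = ∏ y ∈ Finset.univ.erase x, z x y := by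
      funext u
      rw [Finset.prod_apply]
      by_cases hu : u = x
      · subst hu
        rw [Pi.single_eq_same, Finset.prod_eq_one]
        intro y hy
        exact hz1 _ _ (Finset.ne_of_mem_erase hy)
      · rw [Pi.single_eq_of_ne hu]
        exact (Finset.prod_eq_zero (f := fun y => z x y u)
          (Finset.mem_erase.2 ⟨hu, Finset.mem_univ u⟩) (hz0 _ _ hu)).symm
    rw [this]
    exact hAW _ (Subalgebra.prod_mem _ fun y hy => hz _ _ (Finset.ne_of_mem_erase hy))
  have hc : c = ∑ x, c x • (Pi.single x 1 : X → ℝ) := by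
    funext u
    simp [Finset.sum_apply, Pi.single_apply]
  rw [hc]
  exact W.sum_mem fun x _ => W.smul_mem _ (hsing x)

/-- **Theorem 1.** If the generator function `f` admits parameters making the first-layer
convolution map injective, then for every common CNN `F` and every `ε > 0` there is a
width `d*` such that for every first-fully-connected-layer width `d₁ ≥ d*`, some
well-defined GO-CNN `G` with generator `f` and width `d₁` has empirical loss within `ε`
of that of `F`. -/
theorem goCNN_matches_empirical_loss
    (p : ℕ) (hp : 3 ≤ p) (N : ℕ) (hN : 1 ≤ N)
    (Img : Fin N → Matrix (Fin p) (Fin p) ℝ) (y : Fin N → ℝ)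
    (hy : ∀ i, y i = 0 ∨ y i = 1)
    (n : ℕ) (f : (Fin n → ℝ) → Matrix (Fin 3) (Fin 3) ℝ)
    (hf : ∃ (od : ℕ) (prm : Fin od → Fin n → ℝ),
      Function.Injective (fun x : Matrix (Fin p) (Fin p) ℝ =>
        fun t : Fin od => conv2d p p 3 hp hp (f (prm t)) x))
    -- parameters of the common CNN `F`
    (d₀F d₁F : ℕ) (kerF : Fin d₀F → Matrix (Fin 3) (Fin 3) ℝ)
    (b₀F : Fin d₀F × Fin (p - 3 + 1) × Fin (p - 3 + 1) → ℝ)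
    (A₁F : Matrix (Fin d₁F) (Fin d₀F × Fin (p - 3 + 1) × Fin (p - 3 + 1)) ℝ)
    (b₁F a₂F : Fin d₁F → ℝ) (b₂F : ℝ)
    (ε : ℝ) (hε : 0 < ε) :
    ∃ dstar : ℕ, ∀ d₁ : ℕ, dstar ≤ d₁ →
      ∃ (od : ℕ) (prm : Fin od → Fin n → ℝ)
        (b₀G : Fin od × Fin (p - 3 + 1) × Fin (p - 3 + 1) → ℝ)
        (A₁G : Matrix (Fin d₁) (Fin od × Fin (p - 3 + 1) × Fin (p - 3 + 1)) ℝ)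
        (b₁G a₂G : Fin d₁ → ℝ) (b₂G : ℝ),
        -- `G` is well defined: the first-layer kernels jointly annihilate only `0`
        (∀ x : Matrix (Fin p) (Fin p) ℝ,
          (∀ t : Fin od, conv2d p p 3 hp hp (f (prm t)) x = 0) → x = 0) ∧
        -- `|Ê_S[G] - Ê_S[F]| ≤ ε`
        |(N : ℝ)⁻¹ * ∑ i : Fin N,
            (sigmoid (cnnOut hp (fun t => f (prm t)) b₀G A₁G b₁G a₂G b₂G (Img i)) - y i) ^ 2 -
         (N : ℝ)⁻¹ * ∑ i : Fin N,
            (sigmoid (cnnOut hp kerF b₀F A₁F b₁F a₂F b₂F (Img i)) - y i) ^ 2| ≤ ε := by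
  classical
  obtain ⟨od, prm, hinj⟩ := hf
  let g : Set.range Img → (Fin od × Fin (p - 3 + 1) × Fin (p - 3 + 1)) → ℝ :=
    fun x q => sigmoid (conv2d p p 3 hp hp (f (prm q.1)) x.1 q.2.1 q.2.2 + 0)
  have hg : Function.Injective g := by
    intro x x' h
    apply Subtype.ext
    apply hinj
    funext t i j
    have := sigmoid_injective (congrFun h (t, i, j))
    simpa using this
  haveI : Fintype (Set.range Img) := Fintype.ofFinite _
  have hmem := sigmoid_span_top g hg
    (fun x => cnnOut hp kerF b₀F A₁F b₁F a₂F b₂F x.1)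
  rw [Submodule.mem_span_set'] at hmem
  obtain ⟨m, a, G, hG⟩ := hmem
  choose wb hwb using fun i => (G i).2
  refine ⟨m, fun d₁ hd => ?_⟩
  obtain ⟨k, rfl⟩ := Nat.exists_eq_add_of_le hd
  refine ⟨od, prm, fun _ => 0, Fin.append (fun i => (wb i).1) (fun _ => 0),
    Fin.append (fun i => (wb i).2) (fun _ => 0), Fin.append a (fun _ => 0), 0, ?_, ?_⟩
  · intro x hx
    apply hinj
    funext t
    simp only [hx t]
    funext i j
    simp [conv2d]
  · have key : ∀ i, cnnOut hp (fun t => f (prm t)) (fun _ => 0)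
        (Fin.append (fun i => (wb i).1) (fun _ => 0) :
          Matrix (Fin (m + k)) (Fin od × Fin (p - 3 + 1) × Fin (p - 3 + 1)) ℝ)
        (Fin.append (fun i => (wb i).2) (fun _ => 0)) (Fin.append a (fun _ => 0)) 0 (Img i)
        = cnnOut hp kerF b₀F A₁F b₁F a₂F b₂F (Img i) := by
      intro i
      have h1 := congrFun hG ⟨Img i, i, rfl⟩
      simp only [Finset.sum_apply, Pi.smul_apply, smul_eq_mul] at h1
      rw [← h1]
      simp only [cnnOut, Fin.sum_univ_add, Fin.append_left, Fin.append_right, zero_mul,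
        Finset.sum_const_zero, add_zero]
      refine Finset.sum_congr rfl fun j _ => ?_
      rw [← hwb j]
      simp [Matrix.mulVec, dotProduct, g, Fin.append_left]
    simp only [key, sub_self, abs_zero]
    exact hε.le
end
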